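/- Let n ≥ 2 and let O be a Hermitian operator on (ℂ²)^{⊗n} with ‖O‖₂ = 1. For j ∈ {1,…,n−1} and σ ∈ {X,Y,Z}, let σ_j denote the Pauli matrix σ acting on the j-th qubit and identity on all other qubits, and write ⟨A⟩ = Tr(A)/2^n. Then (1/(n−1)) · Σ_{j=1}^{n−1} (1/3) · Σ_{σ∈{X,Y,Z}} ⟨O σ_j O σ_j⟩ = 1 − (4/3) · (1/(n−1)) · Σ_{j=1}^{n−1} I_j[O]. -/

import Mathlib

open Matrix Complex BigOperators
open scoped ComplexOrder
noncomputable section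

namespace QC

/-- Operators on the `n`-qudit space `(ℂ^d)^{⊗n}`, as matrices indexed by
computational basis labels `Fin n → Fin d`. -/
abbrev QOp (d n : ℕ) := Matrix (Fin n → Fin d) (Fin n → Fin d) ℂ

/-- The qudit shift operator `X`, with `X|j⟩ = |j+1 mod d⟩`. -/
def shiftX (d : ℕ) : Matrix (Fin d) (Fin d) ℂ :=
  fun i j => if (i : ℕ) = ((j : ℕ) + 1) % d then 1 else 0

/-- The qudit clock operator `Z`, with `Z|j⟩ = e^{2πij/d}|j⟩`. -/
def clockZ (d : ℕ) : Matrix (Fin d) (Fin d) ℂ :=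
  Matrix.diagonal (fun j => Complex.exp (2 * Real.pi * Complex.I * (j : ℕ) / d))

/-- The single-qudit Pauli operator `P_a = X^s Z^t` for `a = (s,t) ∈ ℤ_d × ℤ_d`. -/
def pauli1 (d : ℕ) (a : ZMod d × ZMod d) : Matrix (Fin d) (Fin d) ℂ :=
  shiftX d ^ a.1.val * clockZ d ^ a.2.val

/-- The `n`-qudit Pauli operator `P_ā = P_{a_1} ⊗ ⋯ ⊗ P_{a_n}`. -/
def pauliN (d n : ℕ) (a : Fin n → ZMod d × ZMod d) : QOp d n :=
  fun x y => ∏ i, pauli1 d (a i) (x i) (y i)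

/-- The weight `|ā|`: the number of indices `i` with `a_i ≠ (0,0)`. -/
def weight (d n : ℕ) (a : Fin n → ZMod d × ZMod d) : ℕ :=
  (Finset.univ.filter (fun i => a i ≠ 0)).card

/-- `P_O[ā] = |Tr(O P_ā)|² / d^{2n}`. -/
def pdist (d n : ℕ) (O : QOp d n) (a : Fin n → ZMod d × ZMod d) : ℝ :=
  ‖(O * pauliN d n a).trace‖ ^ 2 / (d : ℝ) ^ (2 * n)

/-- The normalized 2-norm `‖O‖₂ = (Tr(O†O)/d^n)^{1/2}`. -/
def l2norm (d n : ℕ) (O : QOp d n) : ℝ :=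
  Real.sqrt (((Oᴴ * O).trace).re / (d : ℝ) ^ n)

/-- The total influence `I[O] = Σ_ā |ā|·P_O[ā]`. -/
def influence (d n : ℕ) [NeZero d] (O : QOp d n) : ℝ :=
  ∑ a : Fin n → ZMod d × ZMod d, (weight d n a : ℝ) * pdist d n O a

/-- The local influence `I_j[O] = Σ_{ā : a_j ≠ 0} P_O[ā]`. -/
def localInfluence (d n : ℕ) [NeZero d] (j : Fin n) (O : QOp d n) : ℝ :=
  ∑ a ∈ Finset.univ.filter (fun a : Fin n → ZMod d × ZMod d => a j ≠ 0), pdist d n O a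

/-- The quantum Fourier entropy `H[O] = -Σ_ā P_O[ā] log₂ P_O[ā]` (with `0·log 0 = 0`). -/
def qEntropy (d n : ℕ) [NeZero d] (O : QOp d n) : ℝ :=
  -∑ a : Fin n → ZMod d × ZMod d, pdist d n O a * Real.logb 2 (pdist d n O a)

/-- The binary entropy `h(x) = -x log₂ x - (1-x) log₂ (1-x)`. -/
def binEntropy (x : ℝ) : ℝ :=
  -(x * Real.logb 2 x) - (1 - x) * Real.logb 2 (1 - x)

/-- Circuit sensitivity `CiS[U] = sup { |I[UOU†] - I[O]| : ‖O‖₂ = 1 }`. -/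
def CiS (d n : ℕ) [NeZero d] (U : QOp d n) : ℝ :=
  sSup {x : ℝ | ∃ O : QOp d n, l2norm d n O = 1 ∧
    x = |influence d n (U * O * Uᴴ) - influence d n O|}

/-- Magic power `𝓜[U] = sup { |H[UOU†] - H[O]| : ‖O‖₂ = 1 }`. -/
def magicPower (d n : ℕ) [NeZero d] (U : QOp d n) : ℝ :=
  sSup {x : ℝ | ∃ O : QOp d n, l2norm d n O = 1 ∧
    x = |qEntropy d n (U * O * Uᴴ) - qEntropy d n O|}

/-- Magic entropy `M[U] = max { H[U P_ā U†] : |ā| = 1 }`. -/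
def magicEntropy (d n : ℕ) [NeZero d] (U : QOp d n) : ℝ :=
  sSup {x : ℝ | ∃ a : Fin n → ZMod d × ZMod d, weight d n a = 1 ∧
    x = qEntropy d n (U * pauliN d n a * Uᴴ)}

/-- The operator norm `‖A‖∞` (the L2 → L2 operator norm). -/
def opNorm (d n : ℕ) (A : QOp d n) : ℝ :=
  ‖Matrix.toEuclideanCLM (𝕜 := ℂ) (n := Fin n → Fin d) A‖

/-- The influence rate `R_I(H,O)`. -/
def influenceRate (d n : ℕ) [NeZero d] (H O : QOp d n) : ℂ :=
  (Complex.I / (d : ℂ) ^ (2 * n)) * ∑ a : Fin n → ZMod d × ZMod d, (weight d n a : ℂ) *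
    (((O * H - H * O) * pauliN d n a).trace * (O * (pauliN d n a)ᴴ).trace +
     ((O * H - H * O) * (pauliN d n a)ᴴ).trace * (O * pauliN d n a).trace)

/-- The magic rate `R_M(H,O)`. -/
def magicRate (d n : ℕ) [NeZero d] (H O : QOp d n) : ℂ :=
  (Complex.I / (d : ℂ) ^ (2 * n)) * ∑ a : Fin n → ZMod d × ZMod d,
    (((O * H - H * O) * pauliN d n a).trace * (O * (pauliN d n a)ᴴ).trace +
     ((O * H - H * O) * (pauliN d n a)ᴴ).trace * (O * pauliN d n a).trace) *
    (Real.logb 2 (pdist d n O a) : ℂ)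

/-- Extend an operator on the first `k` qudits by the identity: `H₀ ⊗ I`. -/
def extendOp (d k n : ℕ) (h : k ≤ n) (H0 : QOp d k) : QOp d n :=
  fun x y => if ∀ i : Fin n, k ≤ (i : ℕ) → x i = y i
    then H0 (fun i => x (Fin.castLE h i)) (fun i => y (Fin.castLE h i)) else 0

/-- The tensor product `A ⊗ B` of an `n₁`-qudit and an `n₂`-qudit operator. -/
def tensorOp (d n₁ n₂ : ℕ) (A : QOp d n₁) (B : QOp d n₂) : QOp d (n₁ + n₂) :=
  fun x y => A (fun i => x (Fin.castAdd n₂ i)) (fun i => y (Fin.castAdd n₂ i)) *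
             B (fun i => x (Fin.natAdd n₁ i)) (fun i => y (Fin.natAdd n₁ i))

/-- Embed a single-qudit operator `W` at position `j` (identity elsewhere). -/
def embedAt (d n : ℕ) (j : Fin n) (W : Matrix (Fin d) (Fin d) ℂ) : QOp d n :=
  fun x y => if ∀ i, i ≠ j → x i = y i then W (x j) (y j) else 0

/-- The swap unitary exchanging qudits `i` and `j`. -/
def swapOp (d n : ℕ) (i j : Fin n) : QOp d n :=
  fun x y => if x = y ∘ Equiv.swap i j then 1 else 0

/-- The qubit Pauli X matrix. -/
def pauliX : Matrix (Fin 2) (Fin 2) ℂ := !![0, 1; 1, 0]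

/-- The qubit Pauli Y matrix. -/
def pauliY : Matrix (Fin 2) (Fin 2) ℂ := !![0, -Complex.I; Complex.I, 0]

/-- The qubit Pauli Z matrix. -/
def pauliZ : Matrix (Fin 2) (Fin 2) ℂ := !![1, 0; 0, -1]

/-- The ordered product `γ^S = ∏_{i∈S} γ_i` (factors in increasing index order). -/
def gammaProd (n : ℕ) (γ : Fin (2 * n) → QOp 2 n) (S : Finset (Fin (2 * n))) : QOp 2 n :=
  ((S.sort (· ≤ ·)).map γ).prod

/-- `P^G_O[S] = |Tr((γ^S)† O)|² / 2^{2n}`. -/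
def pdistG (n : ℕ) (γ : Fin (2 * n) → QOp 2 n) (O : QOp 2 n) (S : Finset (Fin (2 * n))) : ℝ :=
  ‖((gammaProd n γ S)ᴴ * O).trace‖ ^ 2 / (2 : ℝ) ^ (2 * n)

/-- The Gaussian influence `I^G[O] = Σ_S |S|·P^G_O[S]`. -/
def influenceG (n : ℕ) (γ : Fin (2 * n) → QOp 2 n) (O : QOp 2 n) : ℝ :=
  ∑ S : Finset (Fin (2 * n)), (S.card : ℝ) * pdistG n γ O S

/-- The Gaussian Fourier entropy `H^G[O] = -Σ_S P^G_O[S] log₂ P^G_O[S]`. -/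
def entropyG (n : ℕ) (γ : Fin (2 * n) → QOp 2 n) (O : QOp 2 n) : ℝ :=
  -∑ S : Finset (Fin (2 * n)), pdistG n γ O S * Real.logb 2 (pdistG n γ O S)

/-- Gaussian circuit sensitivity `CiS^G[U] = sup { |I^G[UOU†] - I^G[O]| : ‖O‖₂ = 1 }`. -/
def CiSG (n : ℕ) (γ : Fin (2 * n) → QOp 2 n) (U : QOp 2 n) : ℝ :=
  sSup {x : ℝ | ∃ O : QOp 2 n, l2norm 2 n O = 1 ∧
    x = |influenceG n γ (U * O * Uᴴ) - influenceG n γ O|}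

/-- Fourier coefficient `f̂(S)` of a Boolean function `f : {-1,1}^n → ℝ`, with
the domain encoded as `Fin n → Bool` (`true ↦ -1`, `false ↦ 1`). -/
def fourierCoeff (n : ℕ) (f : (Fin n → Bool) → ℝ) (S : Finset (Fin n)) : ℝ :=
  (∑ x : Fin n → Bool, f x * ∏ i ∈ S, (if x i then -1 else 1)) / 2 ^ n

/-- Fourier entropy of a Boolean function. -/
def boolEntropy (n : ℕ) (f : (Fin n → Bool) → ℝ) : ℝ :=
  -∑ S : Finset (Fin n), (fourierCoeff n f S) ^ 2 * Real.logb 2 ((fourierCoeff n f S) ^ 2)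

/-- Total influence of a Boolean function. -/
def boolInfluence (n : ℕ) (f : (Fin n → Bool) → ℝ) : ℝ :=
  ∑ S : Finset (Fin n), (S.card : ℝ) * (fourierCoeff n f S) ^ 2

/-- The completely dephasing channel `Δ`. -/
def dephase (d n : ℕ) (A : QOp d n) : QOp d n :=
  Matrix.diagonal (fun i => A i i)

/-- The diagonal matrix `log₂ Δ(ρ)` (entrywise base-2 logarithm of the diagonal). -/
def logDephase (d n : ℕ) (A : QOp d n) : QOp d n :=
  Matrix.diagonal (fun i => (Real.logb 2 (A i i).re : ℂ))

/-- The coherence rate `R_C(H,ρ) = -i Tr([ρ, log Δ(ρ)] H)`. -/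
def cohRate (d n : ℕ) (H ρ : QOp d n) : ℂ :=
  -Complex.I * ((ρ * logDephase d n ρ - logDephase d n ρ * ρ) * H).trace

/-- The max-relative entropy `D_max(ρ‖σ) = log₂ min{λ > 0 : ρ ≤ λσ}`. -/
def Dmax (d n : ℕ) (ρ σ : QOp d n) : ℝ :=
  Real.logb 2 (sInf {l : ℝ | 0 < l ∧ ((l : ℂ) • σ - ρ).PosSemidef})

lemma shiftX_two : shiftX 2 = pauliX := by
  ext i j
  fin_cases i <;> fin_cases j <;> simp [shiftX, pauliX]

lemma clockZ_two : clockZ 2 = pauliZ := by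
  have h : Complex.exp (2 * Real.pi * Complex.I / 2) = -1 := by
    rw [show (2 * Real.pi * Complex.I / 2 : ℂ) = Real.pi * Complex.I by ring, Complex.exp_pi_mul_I]
  ext i j
  fin_cases i <;> fin_cases j <;> simp [clockZ, pauliZ, h]

/-- Completeness of the single-qubit Pauli basis. -/
lemma sum_pauli1_mul_star (y x u v : Fin 2) :
    ∑ b : ZMod 2 × ZMod 2, pauli1 2 b y x * star (pauli1 2 b u v) =
      2 * ((1 : Matrix (Fin 2) (Fin 2) ℂ) y u * (1 : Matrix (Fin 2) (Fin 2) ℂ) v x) := by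
  have h2 (f : ZMod 2 → ℂ) : ∑ s, f s = f 0 + f 1 := Fin.sum_univ_two f
  have h1 : (1 : ZMod 2).val = 1 := rfl
  simp only [Fintype.sum_prod_type, h2, pauli1, shiftX_two, clockZ_two, ZMod.val_zero, h1,
    pow_zero, pow_one, mul_one, one_mul]
  fin_cases y <;> fin_cases x <;> fin_cases u <;> fin_cases v <;>
    norm_num [pauliX, pauliZ, Matrix.mul_apply]

lemma pauli1_zero (d : ℕ) : pauli1 d 0 = 1 := by
  simp [pauli1]

/-- The single-qubit Pauli twirl, entrywise. -/
lemma pauli_twirl_apply (y x u v : Fin 2) :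
    (1 : Matrix (Fin 2) (Fin 2) ℂ) y u * (1 : Matrix (Fin 2) (Fin 2) ℂ) v x
      + pauliX y u * pauliX v x + pauliY y u * pauliY v x + pauliZ y u * pauliZ v x =
      2 * ((1 : Matrix (Fin 2) (Fin 2) ℂ) y x * (1 : Matrix (Fin 2) (Fin 2) ℂ) u v) := by
  fin_cases y <;> fin_cases x <;> fin_cases u <;> fin_cases v <;>
    norm_num [pauliX, pauliY, pauliZ]

lemma embedAt_apply (d n : ℕ) (j : Fin n) (W : Matrix (Fin d) (Fin d) ℂ) (x y : Fin n → Fin d) :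
    embedAt d n j W x y =
      W (x j) (y j) * ∏ i ∈ Finset.univ.erase j, (1 : Matrix (Fin d) (Fin d) ℂ) (x i) (y i) := by
  simp [embedAt, Matrix.one_apply, Finset.prod_boole]

lemma embedAt_one (d n : ℕ) (j : Fin n) : embedAt d n j 1 = 1 := by
  ext x y
  rw [embedAt_apply, Finset.mul_prod_erase _
    (fun i => (1 : Matrix (Fin d) (Fin d) ℂ) (x i) (y i)) (Finset.mem_univ j)]
  simp [Matrix.one_apply, Fintype.prod_boole, funext_iff]

lemma trace_mul_four {m : Type*} [Fintype m] (A B C D : Matrix m m ℂ) :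
    (A * B * C * D).trace = ∑ x, ∑ y, ∑ u, ∑ v, A x y * C u v * (B y u * D v x) := by
  rw [Matrix.mul_assoc (A * B)]
  have htr (M N : Matrix m m ℂ) : (M * N).trace = ∑ x, ∑ u, M x u * N u x := by
    simp only [Matrix.trace, Matrix.diag_apply, Matrix.mul_apply]
  simp only [htr, Matrix.mul_apply, Finset.sum_mul_sum]
  refine Finset.sum_congr rfl fun x _ => ?_
  rw [Finset.sum_comm]
  refine Finset.sum_congr rfl fun y _ => Finset.sum_congr rfl fun u _ =>
    Finset.sum_congr rfl fun v _ => by ring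

/-- Sums of squared Pauli coefficients over a product set of labels factor over the sites. -/
lemma sum_normSq_trace_mul_pauliN {d n : ℕ} (O : QOp d n) (hO : O.IsHermitian)
    (t : Fin n → Finset (ZMod d × ZMod d)) :
    ∑ a ∈ Fintype.piFinset t, ((‖(O * pauliN d n a).trace‖ ^ 2 : ℝ) : ℂ) =
      ∑ x, ∑ y, ∑ u, ∑ v, O x y * O u v *
        ∏ i, ∑ b ∈ t i, pauli1 d b (y i) (x i) * star (pauli1 d b (u i) (v i)) := by
  have key (a : Fin n → ZMod d × ZMod d) : ((‖(O * pauliN d n a).trace‖ ^ 2 : ℝ) : ℂ) =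
      ∑ x, ∑ y, ∑ u, ∑ v, O x y * O u v *
        ∏ i, pauli1 d (a i) (y i) (x i) * star (pauli1 d (a i) (u i) (v i)) := by
    have hstar : star (O * pauliN d n a).trace =
        ∑ u, ∑ v, O u v * star (pauliN d n a u v) := by
      simp only [Matrix.trace, Matrix.diag_apply, Matrix.mul_apply, star_sum, star_mul']
      rw [Finset.sum_comm]
      simp only [hO.apply]
    push_cast
    rw [← Complex.mul_conj', starRingEnd_apply, hstar]
    simp only [Matrix.trace, Matrix.diag_apply, Matrix.mul_apply, Finset.sum_mul]
    simp only [Finset.mul_sum, pauliN, star_prod, Finset.prod_mul_distrib]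
    refine Finset.sum_congr rfl fun x _ => Finset.sum_congr rfl fun y _ =>
      Finset.sum_congr rfl fun u _ => Finset.sum_congr rfl fun v _ => by ring
  simp only [key, Finset.prod_univ_sum, Finset.mul_sum]
  rw [Finset.sum_comm]
  refine Finset.sum_congr rfl fun x _ => ?_
  rw [Finset.sum_comm]
  refine Finset.sum_congr rfl fun y _ => ?_
  rw [Finset.sum_comm]
  refine Finset.sum_congr rfl fun u _ => ?_
  rw [Finset.sum_comm]

/-- Parseval's identity for the qubit Pauli basis. -/
lemma sum_normSq_trace_eq {n : ℕ} (O : QOp 2 n) (hO : O.IsHermitian) :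
    ∑ a, ((‖(O * pauliN 2 n a).trace‖ ^ 2 : ℝ) : ℂ) = 2 ^ n * (O * O).trace := by
  have hp (x y : Fin n → Fin 2) :
      ∏ i, (1 : Matrix (Fin 2) (Fin 2) ℂ) (x i) (y i) = (1 : QOp 2 n) x y := by
    simp [Matrix.one_apply, Fintype.prod_boole, funext_iff]
  have h := sum_normSq_trace_mul_pauliN O hO fun _ => Finset.univ
  rw [Fintype.piFinset_univ] at h
  have h4 := trace_mul_four O 1 O 1
  rw [mul_one, mul_one] at h4
  rw [h, h4]
  simp only [sum_pauli1_mul_star, Finset.prod_mul_distrib, hp, Finset.prod_const,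
    Finset.card_univ, Fintype.card_fin, Finset.mul_sum]
  refine Finset.sum_congr rfl fun x _ => Finset.sum_congr rfl fun y _ =>
    Finset.sum_congr rfl fun u _ => Finset.sum_congr rfl fun v _ => by ring

/-- The Pauli weight of `O` on labels trivial at `j` is an average of out-of-time-order
correlators at `j`. -/
lemma sum_normSq_trace_trivial_at {n : ℕ} (O : QOp 2 n) (hO : O.IsHermitian) (j : Fin n) :
    4 * ∑ a with a j = 0, ((‖(O * pauliN 2 n a).trace‖ ^ 2 : ℝ) : ℂ) =
      2 ^ n * ((O * O).trace
        + (O * embedAt 2 n j pauliX * O * embedAt 2 n j pauliX).trace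
        + (O * embedAt 2 n j pauliY * O * embedAt 2 n j pauliY).trace
        + (O * embedAt 2 n j pauliZ * O * embedAt 2 n j pauliZ).trace) := by
  have hset : (Finset.univ.filter fun a : Fin n → ZMod 2 × ZMod 2 => a j = 0) =
      Fintype.piFinset fun i => if i = j then {0} else Finset.univ := by
    ext a
    simp only [Finset.mem_filter, Finset.mem_univ, true_and, Fintype.mem_piFinset]
    refine ⟨fun h i => ?_, fun h => by simpa using h j⟩
    split_ifs with hi
    · simp [hi, h]
    · simp
  have h1 := trace_mul_four O (embedAt 2 n j 1) O (embedAt 2 n j 1)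
  rw [embedAt_one, mul_one, mul_one, ← embedAt_one 2 n j] at h1
  have hn : (2 : ℂ) ^ n = 2 * 2 ^ (n - 1) := by
    rw [← pow_succ', Nat.sub_add_cancel (Nat.one_le_of_lt j.isLt)]
  rw [hset, sum_normSq_trace_mul_pauliN O hO, h1]
  simp only [trace_mul_four, ← Finset.sum_add_distrib, Finset.mul_sum]
  refine Finset.sum_congr rfl fun x _ => Finset.sum_congr rfl fun y _ =>
    Finset.sum_congr rfl fun u _ => Finset.sum_congr rfl fun v _ => ?_
  rw [← Finset.mul_prod_erase _ _ (Finset.mem_univ j)]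
  have hr : ∏ i ∈ Finset.univ.erase j, ∑ b ∈ (if i = j then {0} else Finset.univ),
      pauli1 2 b (y i) (x i) * star (pauli1 2 b (u i) (v i)) =
      2 ^ (n - 1) * ((∏ i ∈ Finset.univ.erase j, (1 : Matrix (Fin 2) (Fin 2) ℂ) (y i) (u i)) *
        ∏ i ∈ Finset.univ.erase j, (1 : Matrix (Fin 2) (Fin 2) ℂ) (v i) (x i)) := by
    rw [Finset.prod_congr rfl fun i hi => by
      rw [if_neg (Finset.ne_of_mem_erase hi), sum_pauli1_mul_star]]
    simp [Finset.prod_mul_distrib, Finset.card_erase_of_mem]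
  have hstar : star ((1 : Matrix (Fin 2) (Fin 2) ℂ) (u j) (v j)) =
      (1 : Matrix (Fin 2) (Fin 2) ℂ) (u j) (v j) := by
    rw [Matrix.one_apply]; split_ifs <;> simp
  rw [hr, if_pos rfl, Finset.sum_singleton, pauli1_zero, hstar, hn]
  simp only [embedAt_apply]
  generalize (∏ i ∈ Finset.univ.erase j, (1 : Matrix (Fin 2) (Fin 2) ℂ) (y i) (u i)) = R
  generalize (∏ i ∈ Finset.univ.erase j, (1 : Matrix (Fin 2) (Fin 2) ℂ) (v i) (x i)) = S
  linear_combination (-2 * 2 ^ (n - 1) * O x y * O u v * R * S) *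
    pauli_twirl_apply (y j) (x j) (u j) (v j)

lemma trace_mul_self_eq_of_l2norm_eq_one {d n : ℕ} [NeZero d] {O : QOp d n} (hO : O.IsHermitian)
    (hO2 : l2norm d n O = 1) : (O * O).trace = (d : ℂ) ^ n := by
  have hre : ((O * O).trace).re = (d : ℝ) ^ n := by
    rw [l2norm, Real.sqrt_eq_one, hO.eq] at hO2
    exact (div_eq_one_iff_eq (pow_ne_zero _ (NeZero.ne _))).1 hO2
  have him : star (O * O).trace = (O * O).trace := by
    rw [← Matrix.trace_conjTranspose, Matrix.conjTranspose_mul, hO.eq]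
  rw [← Complex.conj_eq_iff_re.1 him, hre]
  push_cast
  rfl

/-- The out-of-time-order correlators at a site determine the local influence at that site. -/
lemma otoc_eq_localInfluence {n : ℕ} (O : QOp 2 n) (hO : O.IsHermitian)
    (hO2 : l2norm 2 n O = 1) (j : Fin n) :
    (O * embedAt 2 n j pauliX * O * embedAt 2 n j pauliX).trace / 2 ^ n +
      (O * embedAt 2 n j pauliY * O * embedAt 2 n j pauliY).trace / 2 ^ n +
      (O * embedAt 2 n j pauliZ * O * embedAt 2 n j pauliZ).trace / 2 ^ n =
    3 - 4 * (localInfluence 2 n j O : ℂ) := by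
  have htr := trace_mul_self_eq_of_l2norm_eq_one hO hO2
  have hsum := sum_normSq_trace_eq O hO
  have htriv := sum_normSq_trace_trivial_at O hO j
  rw [← Finset.sum_filter_add_sum_filter_not Finset.univ (fun a => a j = 0)] at hsum
  have hinf : (localInfluence 2 n j O : ℂ) =
      (∑ a with ¬ a j = 0, ((‖(O * pauliN 2 n a).trace‖ ^ 2 : ℝ) : ℂ)) / (2 ^ n * 2 ^ n) := by
    rw [localInfluence, Finset.sum_div]
    push_cast [pdist, two_mul, pow_add]
    rfl
  have h2 : (2 : ℂ) ^ n ≠ 0 := by positivity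
  rw [htr] at hsum htriv
  push_cast at hsum htriv
  rw [hinf]
  field_simp
  push_cast
  linear_combination (-1 : ℂ) * htriv + 4 * hsum

/-- **Average OTOC–influence relation** for qubits. -/
theorem average_otoc_influence (n : ℕ) (hn : 2 ≤ n) (O : QOp 2 n)
    (hO : O.IsHermitian) (hO2 : l2norm 2 n O = 1) :
    (1 / ((n : ℂ) - 1)) * ∑ j : Fin (n - 1), (1 / 3) *
      (((O * embedAt 2 n (Fin.castLE (Nat.sub_le n 1) j) pauliX * O *
          embedAt 2 n (Fin.castLE (Nat.sub_le n 1) j) pauliX).trace / 2 ^ n) +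
       ((O * embedAt 2 n (Fin.castLE (Nat.sub_le n 1) j) pauliY * O *
          embedAt 2 n (Fin.castLE (Nat.sub_le n 1) j) pauliY).trace / 2 ^ n) +
       ((O * embedAt 2 n (Fin.castLE (Nat.sub_le n 1) j) pauliZ * O *
          embedAt 2 n (Fin.castLE (Nat.sub_le n 1) j) pauliZ).trace / 2 ^ n))
    = 1 - (4 / 3) * (1 / ((n : ℂ) - 1)) *
        ((∑ j : Fin (n - 1),
          localInfluence 2 n (Fin.castLE (Nat.sub_le n 1) j) O : ℝ) : ℂ) := by
  have hn1 : (n : ℂ) - 1 ≠ 0 := by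
    rw [sub_ne_zero]
    exact_mod_cast (show n ≠ 1 by omega)
  simp only [otoc_eq_localInfluence O hO hO2, ← Finset.mul_sum, Finset.sum_sub_distrib,
    Finset.sum_const, Finset.card_univ, Fintype.card_fin, nsmul_eq_mul,
    Nat.cast_sub (show 1 ≤ n by omega), Nat.cast_one, Complex.ofReal_sum]
  field_simp

end QC
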